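/- Suppose T_1, T_2 are words and 1 ≤ i ≤ n−2 are such that R_1 = T_1·i(i+1)i·T_2 and R_2 = T_1·(i+1)i(i+1)·T_2 are both reduced words for the longest element w_0 ∈ S_n. Let u = w(T_1), a = u(i), b = u(i+1), c = u(i+2) (then a < b < c), and assume T_{R_1}(a,b,c) = +1 and T_{R_2}(a,b,c) = −1. Then for every triple 1 ≤ d < e < f ≤ n: Θ_{R_1}(d,e,f) − Θ_{R_2}(d,e,f) = −2 if (d,e,f) = (a,b,c), and Θ_{R_1}(d,e,f) − Θ_{R_2}(d,e,f) = 0 otherwise. -/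

import Mathlib

open scoped Classical

namespace BSDist

/-- The simple transposition `s i` (1-indexed): it swaps the values `i` and `i+1`
of `{1,…,n}`, i.e. the elements `i-1` and `i` of `Fin n`.  Out-of-range letters
give the identity. -/
def sTr (n : ℕ) (i : ℕ) : Equiv.Perm (Fin n) :=
  if h : 1 ≤ i ∧ i < n then Equiv.swap ⟨i - 1, by omega⟩ ⟨i, h.2⟩ else 1

/-- The product `w(R) = s_{i₁} ⋯ s_{i_L}` of a word. -/
def wprod (n : ℕ) (R : List ℕ) : Equiv.Perm (Fin n) := (R.map (sTr n)).prod

/-- The Coxeter length of a permutation: its number of inversions. -/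
def len {n : ℕ} (w : Equiv.Perm (Fin n)) : ℕ :=
  (Finset.univ.filter (fun p : Fin n × Fin n => p.1 < p.2 ∧ w p.2 < w p.1)).card

/-- A word over the alphabet `{1,…,n-1}`. -/
def Alphabet (n : ℕ) (R : List ℕ) : Prop := ∀ i ∈ R, 1 ≤ i ∧ i < n

/-- `R` is a reduced word (over the alphabet `{1,…,n-1}`). -/
def IsReducedWord (n : ℕ) (R : List ℕ) : Prop :=
  Alphabet n R ∧ R.length = len (wprod n R)

/-- `R` is a reduced word for `w`. -/
def IsReducedWordFor (n : ℕ) (R : List ℕ) (w : Equiv.Perm (Fin n)) : Prop :=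
  IsReducedWord n R ∧ wprod n R = w

/-- The weight `wt_R : S_n → ℤ[q]`, defined by the recursion
`wt_∅(e) = 1`, `wt_∅(x) = 0` for `x ≠ e`, and for an appended letter `i`:
`wt_{Ri}(x) = wt_R(x) + wt_R(x sᵢ)` if `ℓ(x sᵢ) > ℓ(x)`, and
`wt_{Ri}(x) = q·wt_R(x) + q·wt_R(x sᵢ)` if `ℓ(x sᵢ) < ℓ(x)`. -/
noncomputable def wt (n : ℕ) (R : List ℕ) : Equiv.Perm (Fin n) → Polynomial ℤ :=
  R.foldl
    (fun f i x =>
      if len x < len (x * sTr n i) then f x + f (x * sTr n i)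
      else Polynomial.X * f x + Polynomial.X * f (x * sTr n i))
    (fun x => if x = 1 then 1 else 0)

/-- A single commutation move: replace a consecutive factor `ij` by `ji` where
`|i - j| > 1`. -/
def CommMove (R R' : List ℕ) : Prop :=
  ∃ (A B : List ℕ) (i j : ℕ), (i + 1 < j ∨ j + 1 < i) ∧
    R = A ++ [i, j] ++ B ∧ R' = A ++ [j, i] ++ B

/-- Commutation equivalence: a finite sequence of commutation moves. -/
def CommEquiv (R R' : List ℕ) : Prop := Relation.ReflTransGen CommMove R R'

/-- A single braid move: replace a consecutive factor `k(k+1)k` by `(k+1)k(k+1)`. -/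
def BraidMove (R R' : List ℕ) : Prop :=
  ∃ (A B : List ℕ) (k : ℕ),
    R = A ++ [k, k + 1, k] ++ B ∧ R' = A ++ [k + 1, k, k + 1] ++ B

/-- The Demazure product of a word, computed left to right:
`w ∗ sᵢ = w sᵢ` if `ℓ(w sᵢ) > ℓ(w)`, and `w ∗ sᵢ = w` otherwise. -/
def dem (n : ℕ) (R : List ℕ) : Equiv.Perm (Fin n) :=
  R.foldl (fun w i => if len w < len (w * sTr n i) then w * sTr n i else w) 1

/-- `app w t` is the value `w(t)` in 1-indexed one-line notation:
positions and values both run through `{1,…,n}`. -/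
def app {n : ℕ} (w : Equiv.Perm (Fin n)) (t : ℕ) : ℕ :=
  if h : 1 ≤ t ∧ t ≤ n then ((w ⟨t - 1, by omega⟩ : Fin n) : ℕ) + 1 else 0

/-- `posOf x t = x⁻¹(t)`, the (1-indexed) position of the value `t` in `x`. -/
def posOf {n : ℕ} (x : Equiv.Perm (Fin n)) (t : ℕ) : ℕ := app x⁻¹ t

/-- The longest element `w₀` of `S_n` (the order-reversing permutation). -/
def w0 (n : ℕ) : Equiv.Perm (Fin n) := ⟨Fin.rev, Fin.rev, Fin.rev_rev, Fin.rev_rev⟩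

/-- The value pair `(a,b)` (with `a < b`) is an inversion of `x`:
`x⁻¹(a) > x⁻¹(b)`. -/
def IsInversion {n : ℕ} (x : Equiv.Perm (Fin n)) (a b : ℕ) : Prop :=
  posOf x b < posOf x a

/-- `tau R a b` is the first time `k` at which the pair `(a,b)` is an inversion
of the prefix product `s_{i₁} ⋯ s_{i_k}`. -/
noncomputable def tau (n : ℕ) (R : List ℕ) (a b : ℕ) : ℕ :=
  sInf {k | IsInversion (wprod n (R.take k)) a b}

/-- `T_R(a,b,c) = +1` if `τ_R(a,b) < τ_R(b,c)` and `-1` otherwise. -/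
noncomputable def T (n : ℕ) (R : List ℕ) (a b c : ℕ) : ℤ :=
  if tau n R a b < tau n R b c then 1 else -1

/-- `Supp(x) = {t : pos_x(t) ≠ pos_{w₀}(t)}`. -/
noncomputable def Supp (n : ℕ) (x : Equiv.Perm (Fin n)) : Finset ℕ :=
  (Finset.Icc 1 n).filter (fun t => posOf x t ≠ posOf (w0 n) t)

/-- `Fwd(x) = {t : pos_x(t) < pos_{w₀}(t)}`. -/
noncomputable def Fwd (n : ℕ) (x : Equiv.Perm (Fin n)) : Finset ℕ :=
  (Finset.Icc 1 n).filter (fun t => posOf x t < posOf (w0 n) t)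

/-- `Bwd(x) = {t : pos_x(t) > pos_{w₀}(t)}`. -/
noncomputable def Bwd (n : ℕ) (x : Equiv.Perm (Fin n)) : Finset ℕ :=
  (Finset.Icc 1 n).filter (fun t => posOf (w0 n) t < posOf x t)

/-- `D_R(x)`: the coefficient of `q^{N-1}` in `wt_R(x)`, where `N = n(n-1)/2`. -/
noncomputable def D (n : ℕ) (R : List ℕ) (x : Equiv.Perm (Fin n)) : ℤ :=
  (wt n R x).coeff (n * (n - 1) / 2 - 1)

/-- `σ_b(x) = sign(pos_x(b) − pos_{w₀}(b)) ∈ {−1,0,+1}`. -/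
noncomputable def sigmaVal (n : ℕ) (b : ℕ) (x : Equiv.Perm (Fin n)) : ℤ :=
  Int.sign ((posOf x b : ℤ) - (posOf (w0 n) b : ℤ))

/-- `Θ_R(a,b,c) = Σ_{x : Supp(x) = [a,c]} D_R(x)·σ_b(x)`. -/
noncomputable def Theta (n : ℕ) (R : List ℕ) (a b c : ℕ) : ℤ :=
  ∑ x ∈ Finset.univ.filter (fun x : Equiv.Perm (Fin n) => Supp n x = Finset.Icc a c),
    D n R x * sigmaVal n b x

end BSDist

namespace BSDist

/-! ### Length and adjacent swaps -/

theorem len_swap_of_lt {n : ℕ} (v : Equiv.Perm (Fin n)) (j j' : Fin n)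
    (hj : j'.val = j.val + 1) (h : v j < v j') :
    len (v * Equiv.swap j j') = len v + 1 := by
  have hne : (j, j') ∉ ((Finset.univ.filter
      (fun p : Fin n × Fin n => p.1 < p.2 ∧ v p.2 < v p.1)).map
      (Equiv.prodCongr (Equiv.swap j j') (Equiv.swap j j')).toEmbedding) := by
    simp only [Finset.mem_map_equiv, Finset.mem_filter]
    simp
    intro h1
    exact absurd h1 (by rw [Fin.lt_def]; omega)
  unfold len
  rw [← Finset.card_map (s := Finset.univ.filter
      (fun p : Fin n × Fin n => p.1 < p.2 ∧ v p.2 < v p.1))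
      (Equiv.prodCongr (Equiv.swap j j') (Equiv.swap j j')).toEmbedding,
    ← Finset.card_insert_of_notMem hne]
  congr 1
  ext ⟨p, q⟩
  have hlt : j < j' := by rw [Fin.lt_def]; omega
  rw [Finset.mem_filter]
  simp only [Finset.mem_insert, Finset.mem_map_equiv, Finset.mem_filter, Finset.mem_univ,
    true_and, Equiv.Perm.mul_apply, Equiv.prodCongr_symm, Equiv.symm_swap,
    Equiv.prodCongr_apply, Prod.map, Prod.mk.injEq]
  have key : (p = j ∧ q = j') ∨ (p = j' ∧ q = j) ∨
      (p < q ↔ Equiv.swap j j' p < Equiv.swap j j' q) := by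
    simp only [Equiv.swap_apply_def, Fin.ext_iff, Fin.lt_def]
    grind
  rcases key with ⟨rfl, rfl⟩ | ⟨rfl, rfl⟩ | key
  · simp [h, hlt]
  · simp [hlt.ne', h.le]
  · constructor
    · rintro ⟨h1, h2⟩
      exact Or.inr ⟨key.1 h1, h2⟩
    · rintro (⟨rfl, rfl⟩ | ⟨h1, h2⟩)
      · simp [h, hlt]
      · exact ⟨key.2 h1, h2⟩

theorem len_lt_iff {n : ℕ} (v : Equiv.Perm (Fin n)) (j j' : Fin n)
    (hj : j'.val = j.val + 1) :
    len v < len (v * Equiv.swap j j') ↔ v j < v j' := by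
  constructor
  · intro h
    by_contra hc
    have hne : v j ≠ v j' := fun h' => by
      have := v.injective h'
      rw [this] at hj; omega
    have h2 : v j' < v j := lt_of_le_of_ne (not_lt.1 hc) (Ne.symm hne)
    have := len_swap_of_lt (v * Equiv.swap j j') j j' hj (by simpa using h2)
    simp [mul_assoc] at this
    omega
  · intro h
    rw [len_swap_of_lt v j j' hj h]; omega

theorem sTr_eq {n i : ℕ} (h : 1 ≤ i ∧ i < n) :
    sTr n i = Equiv.swap (⟨i - 1, by omega⟩ : Fin n) ⟨i, h.2⟩ := by
  simp [sTr, h]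

theorem sTr_mul_self (n i : ℕ) : sTr n i * sTr n i = 1 := by
  unfold sTr; split <;> simp

theorem len_sTr_le {n : ℕ} (v : Equiv.Perm (Fin n)) (i : ℕ) :
    len (v * sTr n i) ≤ len v + 1 := by
  by_cases h : 1 ≤ i ∧ i < n
  · rw [sTr_eq h]
    by_cases h2 : v ⟨i - 1, by omega⟩ < v ⟨i, h.2⟩
    · rw [len_swap_of_lt _ _ _ (by simp; omega) h2]
    · rw [← len_lt_iff _ _ _ (by simp; omega)] at h2; omega
  · simp [sTr, h]

theorem len_lt_iff' {n i : ℕ} (h : 1 ≤ i ∧ i < n) (v : Equiv.Perm (Fin n)) :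
    len v < len (v * sTr n i) ↔ v ⟨i - 1, by omega⟩ < v ⟨i, h.2⟩ := by
  rw [sTr_eq h, len_lt_iff _ _ _ (by simp; omega)]

theorem len_w0 (n : ℕ) : len (w0 n) = n * (n - 1) / 2 := by
  unfold len
  have : (Finset.univ.filter (fun p : Fin n × Fin n => p.1 < p.2 ∧ w0 n p.2 < w0 n p.1))
      = (Finset.univ.sigma (fun q : Fin n => Finset.Iio q)).map
        ⟨fun s => (s.2, s.1), by rintro ⟨a, b⟩ ⟨c, d⟩ h; simp at h; simp [h]⟩ := by
    ext ⟨p, q⟩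
    simp [w0]
    constructor
    · intro h; exact ⟨q, p, h, rfl⟩
    · rintro ⟨a, b, h, h2⟩
      cases h2; exact h
  rw [this, Finset.card_map, Finset.card_sigma]
  simp only [Fin.card_Iio]
  rw [Fin.sum_univ_eq_sum_range (fun i => i) n, Finset.sum_range_id]

/-! ### Demazure steps and the expansion of the weight -/

/-- The upward (Demazure) step. -/
noncomputable def up (n : ℕ) (v : Equiv.Perm (Fin n)) (i : ℕ) : Equiv.Perm (Fin n) :=
  if len v < len (v * sTr n i) then v * sTr n i else v

/-- The downward step. -/
noncomputable def dn (n : ℕ) (v : Equiv.Perm (Fin n)) (i : ℕ) : Equiv.Perm (Fin n) :=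
  if len v < len (v * sTr n i) then v else v * sTr n i

/-- The end points of the paths starting from `v` with exactly one downward step. -/
noncomputable def lst (n : ℕ) : Equiv.Perm (Fin n) → List ℕ → List (Equiv.Perm (Fin n))
  | _, [] => []
  | v, i :: R => R.foldl (up n) (dn n v i) :: lst n (up n v i) R

theorem lst_append (n : ℕ) (A B : List ℕ) (v : Equiv.Perm (Fin n)) :
    lst n v (A ++ B) = (lst n v A).map (fun y => B.foldl (up n) y)
      ++ lst n (A.foldl (up n) v) B := by
  induction A generalizing v with
  | nil => simp [lst]
  | cons i A ih => simp [lst, ih]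

/-- One step of the weight recursion. -/
noncomputable def stp (n : ℕ) (f : Equiv.Perm (Fin n) → Polynomial ℤ) (i : ℕ) :
    Equiv.Perm (Fin n) → Polynomial ℤ := fun x =>
  if len x < len (x * sTr n i) then f x + f (x * sTr n i)
  else Polynomial.X * f x + Polynomial.X * f (x * sTr n i)

/-- The indicator function of `v`. -/
noncomputable def dl (n : ℕ) (v : Equiv.Perm (Fin n)) : Equiv.Perm (Fin n) → Polynomial ℤ :=
  fun x => if x = v then 1 else 0

theorem wt_eq (n : ℕ) (R : List ℕ) : wt n R = R.foldl (stp n) (dl n 1) := rfl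

theorem foldl_lin (n : ℕ) (R : List ℕ) (f g : Equiv.Perm (Fin n) → Polynomial ℤ) :
    R.foldl (stp n) (fun x => Polynomial.X * f x + g x)
      = fun x => Polynomial.X * R.foldl (stp n) f x + R.foldl (stp n) g x := by
  induction R generalizing f g with
  | nil => rfl
  | cons i R ih =>
    simp only [List.foldl_cons]
    rw [← ih]
    congr 1
    funext x
    unfold stp
    split <;> ring

theorem stp_dl {n i : ℕ} (h : 1 ≤ i ∧ i < n) (v : Equiv.Perm (Fin n)) :
    stp n (dl n v) i = fun x => Polynomial.X * dl n (up n v i) x + dl n (dn n v i) x := by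
  have hs := sTr_mul_self n i
  have key : ∀ x : Equiv.Perm (Fin n), x * sTr n i * sTr n i = x := fun x => by
    rw [mul_assoc, hs, mul_one]
  have hlen : ∀ x : Equiv.Perm (Fin n), len (x * sTr n i) ≠ len x := by
    intro x hx
    have h1 := len_lt_iff' h x
    have h2 := len_lt_iff' h (x * sTr n i)
    rw [key] at h2
    rw [hx] at h1 h2
    simp only [lt_irrefl, false_iff] at h1 h2
    rw [sTr_eq h] at h2
    simp at h1 h2
    have := x.injective (le_antisymm h1 h2)
    simp [Fin.ext_iff] at this
    omega
  funext x
  unfold stp dl up dn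
  have e1 : x * sTr n i = v ↔ x = v * sTr n i := by
    constructor
    · rintro rfl; rw [key]
    · rintro rfl; rw [key]
  have hne : v * sTr n i ≠ v := fun h => hlen v (by rw [h])
  have := hlen v
  have := hlen x
  by_cases hx : x = v
  · subst hx
    simp only [if_true, e1, if_neg hne.symm]
    by_cases hl : len x < len (x * sTr n i)
    · simp only [if_pos hl, if_neg hne.symm]; simp
    · simp only [if_neg hl, if_neg hne.symm]; simp
  · by_cases hx2 : x = v * sTr n i
    · subst hx2
      rw [key]
      simp only [if_neg hne, if_true]
      by_cases hl : len v < len (v * sTr n i)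
      · rw [if_neg (by omega), if_pos hl, if_pos hl]; simp [hne]
      · rw [if_pos (by omega), if_neg hl, if_neg hl]; simp [hne]
    · by_cases hl : len v < len (v * sTr n i)
      · simp only [if_pos hl, hx, e1, hx2]; simp
      · simp only [if_neg hl, hx, e1, hx2]; simp

theorem coeff_facts (n : ℕ) (R : List ℕ) (hR : Alphabet n R) (v x : Equiv.Perm (Fin n)) :
    (∀ k, R.length < k → (R.foldl (stp n) (dl n v) x).coeff k = 0) ∧
    ((R.foldl (stp n) (dl n v) x).coeff R.length
      = if x = R.foldl (up n) v then 1 else 0) ∧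
    (∀ k, k + 1 = R.length →
      (R.foldl (stp n) (dl n v) x).coeff k = ((lst n v R).count x : ℤ)) := by
  induction R generalizing v with
  | nil =>
    refine ⟨?_, ?_, ?_⟩
    · intro k hk
      simp only [List.length_nil] at hk
      simp only [List.foldl_nil, dl]
      split <;> simp [Polynomial.coeff_one]; omega
    · change (dl n v x).coeff 0 = if x = v then 1 else 0
      unfold dl
      by_cases hx : x = v
      · rw [if_pos hx, if_pos hx]; simp
      · rw [if_neg hx, if_neg hx]; simp
    · intro k hk; simp at hk
  | cons i R ih =>
    have hi : 1 ≤ i ∧ i < n := hR i (by simp)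
    have hR' : Alphabet n R := fun j hj => hR j (by simp [hj])
    simp only [List.foldl_cons, stp_dl hi, foldl_lin, List.length_cons, Polynomial.coeff_add]
    obtain ⟨u1, u2, u3⟩ := ih hR' (up n v i)
    obtain ⟨d1, d2, d3⟩ := ih hR' (dn n v i)
    refine ⟨?_, ?_, ?_⟩
    · intro k hk
      obtain ⟨m, rfl⟩ : ∃ m, k = m + 1 := ⟨k - 1, by omega⟩
      rw [Polynomial.coeff_X_mul, u1 _ (by omega), d1 _ (by omega), add_zero]
    · rw [Polynomial.coeff_X_mul, u2, d1 _ (by omega), add_zero]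
      congr
    · intro k hk
      have hk' : k = R.length := by omega
      subst hk'
      rw [d2]
      rcases hc : R.length with _ | m
      · have : R = [] := List.length_eq_zero_iff.1 hc
        subst this
        simp only [lst, List.count_cons, List.count_nil,
          Polynomial.coeff_X_mul_zero, List.foldl_nil, beq_iff_eq, zero_add]
        push_cast
        simp only [eq_comm]
        congr
      · rw [Polynomial.coeff_X_mul, u3 m (by omega)]
        simp only [lst, List.count_cons, beq_iff_eq]
        push_cast
        congr 1
        simp [eq_comm]

theorem sum_count {α : Type*} [Fintype α] [DecidableEq α] (P : α → Prop) [DecidablePred P]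
    (s : α → ℤ) (L : List α) :
    ∑ x ∈ Finset.univ.filter P, (L.count x : ℤ) * s x
      = (L.map (fun x => if P x then s x else 0)).sum := by
  induction L with
  | nil => simp
  | cons y L ih =>
    simp only [List.count_cons, List.map_cons, List.sum_cons, ← ih]
    push_cast
    simp only [add_mul, Finset.sum_add_distrib]
    rw [add_comm]
    congr 1
    simp

/-- The summand of `Θ`. -/
noncomputable def phi (n d e f : ℕ) (x : Equiv.Perm (Fin n)) : ℤ :=
  if Supp n x = Finset.Icc d f then sigmaVal n e x else 0

theorem Theta_eq (n : ℕ) (R : List ℕ) (hR : Alphabet n R)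
    (hlen : R.length = n * (n - 1) / 2) (h1 : 1 ≤ R.length) (d e f : ℕ) :
    Theta n R d e f = ((lst n 1 R).map (phi n d e f)).sum := by
  unfold Theta phi
  rw [← sum_count]
  apply Finset.sum_congr rfl
  intro x _
  congr 1
  unfold D
  rw [wt_eq]
  exact (coeff_facts n R hR 1 x).2.2 _ (by omega)

/-! ### Invariants for three-letter words -/

/-- Sorting step (decreasing) on words. -/
def srt {n : ℕ} (f : Fin n → ℕ) (j j' : Fin n) : Fin n → ℕ :=
  fun k => if k = j then max (f j) (f j') else if k = j' then min (f j) (f j') else f k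

/-- Invariant for a letter which ends up moved to the left. -/
def InvL {n : ℕ} (f g : Fin n → ℕ) : Prop :=
  ∃ x y z : Fin n, x < y ∧ y < z ∧ g x = 1 ∧ g y = 0 ∧ g z = 2 ∧ f z = 0 ∧
    ((f x = 1 ∧ f y = 2) ∨ (f x = 2 ∧ f y = 1)) ∧
    ∀ o, o ≠ x → o ≠ y → o ≠ z → f o = g o ∧ (f o = 0 ∨ f o = 2)

/-- Invariant for a letter which ends up moved to the right. -/
def InvR {n : ℕ} (f g : Fin n → ℕ) : Prop :=
  ∃ x y z : Fin n, x < y ∧ y < z ∧ g x = 0 ∧ g y = 2 ∧ g z = 1 ∧ f x = 2 ∧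
    ((f y = 0 ∧ f z = 1) ∨ (f y = 1 ∧ f z = 0)) ∧
    ∀ o, o ≠ x → o ≠ y → o ≠ z → f o = g o ∧ (f o = 0 ∨ f o = 2)

/-- Invariant for the smallest letter of the support. -/
def InvA {n : ℕ} (f g : Fin n → ℕ) : Prop :=
  ∃ x y : Fin n, x < y ∧ g x = 1 ∧ g y = 2 ∧ f x = 2 ∧ f y = 1 ∧
    ∀ o, o ≠ x → o ≠ y → f o = g o ∧ (f o = 0 ∨ f o = 2)

/-- Invariant for the largest letter of the support. -/
def InvC {n : ℕ} (f g : Fin n → ℕ) : Prop :=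
  ∃ x y : Fin n, x < y ∧ g x = 0 ∧ g y = 1 ∧ f x = 1 ∧ f y = 0 ∧
    ∀ o, o ≠ x → o ≠ y → f o = g o ∧ (f o = 0 ∨ f o = 2)

theorem InvA.step {n : ℕ} {f g : Fin n → ℕ} (h : InvA f g) (j j' : Fin n)
    (hj : j'.val = j.val + 1) (hf : f j ≤ f j') : InvA (srt f j j') (srt g j j') := by
  obtain ⟨x, y, hxy, gx, gy, fx, fy, ho⟩ := h
  have oj := ho j
  have oj' := ho j'
  have hjj : j ≠ j' := by rintro rfl; omega
  by_cases h1 : j = x ∨ j = y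
  · by_cases h2 : j' = x ∨ j' = y
    · refine ⟨x, y, ?_⟩; grind (splits := 30) [srt]
    · by_cases h3 : f j' = 2
      · rcases h1 with h1 | h1
        · refine ⟨j', y, ?_⟩; grind (splits := 30) [srt]
        · refine ⟨x, j', ?_⟩; grind (splits := 30) [srt]
      · refine ⟨x, y, ?_⟩; grind (splits := 30) [srt]
  · by_cases h2 : j' = x ∨ j' = y
    · by_cases h3 : f j = 0
      · rcases h2 with h2 | h2
        · refine ⟨j, y, ?_⟩; grind (splits := 30) [srt]
        · refine ⟨x, j, ?_⟩; grind (splits := 30) [srt]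
      · refine ⟨x, y, ?_⟩; grind (splits := 30) [srt]
    · refine ⟨x, y, ?_⟩; grind (splits := 30) [srt]

theorem InvC.step {n : ℕ} {f g : Fin n → ℕ} (h : InvC f g) (j j' : Fin n)
    (hj : j'.val = j.val + 1) (hf : f j ≤ f j') : InvC (srt f j j') (srt g j j') := by
  obtain ⟨x, y, hxy, gx, gy, fx, fy, ho⟩ := h
  have oj := ho j
  have oj' := ho j'
  have hjj : j ≠ j' := by rintro rfl; omega
  by_cases h1 : j = x ∨ j = y
  · by_cases h2 : j' = x ∨ j' = y
    · refine ⟨x, y, ?_⟩; grind (splits := 30) [srt]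
    · by_cases h3 : f j' = 2
      · rcases h1 with h1 | h1
        · refine ⟨j', y, ?_⟩; grind (splits := 30) [srt]
        · refine ⟨x, j', ?_⟩; grind (splits := 30) [srt]
      · refine ⟨x, y, ?_⟩; grind (splits := 30) [srt]
  · by_cases h2 : j' = x ∨ j' = y
    · by_cases h3 : f j = 0
      · rcases h2 with h2 | h2
        · refine ⟨j, y, ?_⟩; grind (splits := 30) [srt]
        · refine ⟨x, j, ?_⟩; grind (splits := 30) [srt]
      · refine ⟨x, y, ?_⟩; grind (splits := 30) [srt]
    · refine ⟨x, y, ?_⟩; grind (splits := 30) [srt]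

theorem InvL.step {n : ℕ} {f g : Fin n → ℕ} (h : InvL f g) (j j' : Fin n)
    (hj : j'.val = j.val + 1) (hf : f j ≤ f j') : InvL (srt f j j') (srt g j j') := by
  obtain ⟨x, y, z, hxy, hyz, gx, gy, gz, fz, hh, ho⟩ := h
  have oj := ho j
  have oj' := ho j'
  have hjj : j ≠ j' := by rintro rfl; omega
  by_cases h1 : j = x ∨ j = y ∨ j = z
  · by_cases h2 : j' = x ∨ j' = y ∨ j' = z
    · refine ⟨x, y, z, ?_⟩; grind (splits := 30) [srt]
    · by_cases h3 : f j' = 2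
      · rcases h1 with h1 | h1 | h1
        · refine ⟨j', y, z, ?_⟩; grind (splits := 30) [srt]
        · refine ⟨x, j', z, ?_⟩; grind (splits := 30) [srt]
        · refine ⟨x, y, j', ?_⟩; grind (splits := 30) [srt]
      · refine ⟨x, y, z, ?_⟩; grind (splits := 30) [srt]
  · by_cases h2 : j' = x ∨ j' = y ∨ j' = z
    · by_cases h3 : f j = 0
      · rcases h2 with h2 | h2 | h2
        · refine ⟨j, y, z, ?_⟩; grind (splits := 30) [srt]
        · refine ⟨x, j, z, ?_⟩; grind (splits := 30) [srt]
        · refine ⟨x, y, j, ?_⟩; grind (splits := 30) [srt]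
      · refine ⟨x, y, z, ?_⟩; grind (splits := 30) [srt]
    · refine ⟨x, y, z, ?_⟩; grind (splits := 30) [srt]

theorem InvR.step {n : ℕ} {f g : Fin n → ℕ} (h : InvR f g) (j j' : Fin n)
    (hj : j'.val = j.val + 1) (hf : f j ≤ f j') : InvR (srt f j j') (srt g j j') := by
  obtain ⟨x, y, z, hxy, hyz, gx, gy, gz, fx, hh, ho⟩ := h
  have oj := ho j
  have oj' := ho j'
  have hjj : j ≠ j' := by rintro rfl; omega
  by_cases h1 : j = x ∨ j = y ∨ j = z
  · by_cases h2 : j' = x ∨ j' = y ∨ j' = z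
    · refine ⟨x, y, z, ?_⟩; grind (splits := 30) [srt]
    · by_cases h3 : f j' = 2
      · rcases h1 with h1 | h1 | h1
        · refine ⟨j', y, z, ?_⟩; grind (splits := 30) [srt]
        · refine ⟨x, j', z, ?_⟩; grind (splits := 30) [srt]
        · refine ⟨x, y, j', ?_⟩; grind (splits := 30) [srt]
      · refine ⟨x, y, z, ?_⟩; grind (splits := 30) [srt]
  · by_cases h2 : j' = x ∨ j' = y ∨ j' = z
    · by_cases h3 : f j = 0
      · rcases h2 with h2 | h2 | h2
        · refine ⟨j, y, z, ?_⟩; grind (splits := 30) [srt]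
        · refine ⟨x, j, z, ?_⟩; grind (splits := 30) [srt]
        · refine ⟨x, y, j, ?_⟩; grind (splits := 30) [srt]
      · refine ⟨x, y, z, ?_⟩; grind (splits := 30) [srt]
    · refine ⟨x, y, z, ?_⟩; grind (splits := 30) [srt]

/-! ### Increasing paths -/

/-- Every letter of the word increases the length, starting from `w`. -/
def Inc (n : ℕ) : Equiv.Perm (Fin n) → List ℕ → Prop
  | _, [] => True
  | w, i :: R => len w < len (w * sTr n i) ∧ Inc n (w * sTr n i) R

theorem wprod_cons (n i : ℕ) (R : List ℕ) : wprod n (i :: R) = sTr n i * wprod n R := by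
  simp [wprod]

theorem wprod_append (n : ℕ) (A B : List ℕ) : wprod n (A ++ B) = wprod n A * wprod n B := by
  simp [wprod]

theorem len_mul_wprod_le (n : ℕ) (R : List ℕ) (w : Equiv.Perm (Fin n)) :
    len (w * wprod n R) ≤ len w + R.length := by
  induction R generalizing w with
  | nil => simp [wprod]
  | cons i R ih =>
    rw [wprod_cons, ← mul_assoc]
    have := ih (w * sTr n i)
    have := len_sTr_le w i
    simp only [List.length_cons]
    omega

theorem Inc_of_len (n : ℕ) (R : List ℕ) (w : Equiv.Perm (Fin n))
    (h : len (w * wprod n R) = len w + R.length) : Inc n w R := by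
  induction R generalizing w with
  | nil => trivial
  | cons i R ih =>
    rw [wprod_cons, ← mul_assoc] at h
    have h1 := len_mul_wprod_le n R (w * sTr n i)
    have h2 := len_sTr_le w i
    simp only [List.length_cons] at h
    exact ⟨by omega, ih _ (by omega)⟩

theorem Inc_append (n : ℕ) (A B : List ℕ) (w : Equiv.Perm (Fin n)) :
    Inc n w (A ++ B) ↔ Inc n w A ∧ Inc n (w * wprod n A) B := by
  induction A generalizing w with
  | nil => simp [Inc, wprod]
  | cons i A ih => simp [Inc, ih, wprod_cons, mul_assoc, and_assoc]

theorem foldl_up_of_Inc (n : ℕ) (R : List ℕ) (w : Equiv.Perm (Fin n)) (h : Inc n w R) :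
    R.foldl (up n) w = w * wprod n R := by
  induction R generalizing w with
  | nil => simp [wprod]
  | cons i R ih =>
    have e : up n w i = w * sTr n i := by unfold up; rw [if_pos h.1]
    rw [List.foldl_cons, e, ih _ h.2, wprod_cons, mul_assoc]

theorem Inc_of_reduced {n : ℕ} {R : List ℕ} (h : IsReducedWord n R) : Inc n 1 R := by
  apply Inc_of_len
  have h1 : len (1 : Equiv.Perm (Fin n)) = 0 := by
    unfold len
    rw [Finset.card_eq_zero, Finset.filter_eq_empty_iff]
    rintro ⟨p, q⟩ _ ⟨h1, h2⟩
    exact absurd h1 (not_lt.2 h2.le)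
  rw [one_mul, h1, zero_add, h.2]

/-! ### Projection to three letters -/

/-- Compare a value with `e`. -/
def lam {n : ℕ} (e k : Fin n) : ℕ := if k < e then 0 else if k = e then 1 else 2

theorem lam_mono {n : ℕ} (e : Fin n) {k l : Fin n} (h : k ≤ l) : lam e k ≤ lam e l := by
  unfold lam; grind

theorem lam_eq_one {n : ℕ} {e k : Fin n} (h : lam e k = 1) : k = e := by
  unfold lam at h; grind

theorem lam_up {n i : ℕ} (h : 1 ≤ i ∧ i < n) (v : Equiv.Perm (Fin n)) (e : Fin n) :
    (fun k => lam e (up n v i k))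
      = srt (fun k => lam e (v k)) ⟨i - 1, by omega⟩ ⟨i, h.2⟩ := by
  funext k
  unfold up
  have hl := len_lt_iff' h v
  by_cases hc : len v < len (v * sTr n i)
  · rw [if_pos hc]
    rw [hl] at hc
    have := lam_mono e hc.le
    rw [sTr_eq h, Equiv.Perm.mul_apply, Equiv.swap_apply_def]
    simp only [srt, max_eq_right this, min_eq_left this]
    split_ifs <;> rfl
  · rw [if_neg hc]
    rw [hl, not_lt] at hc
    have := lam_mono e hc
    simp only [srt, max_eq_left this, min_eq_right this]
    split_ifs with h1 h2
    · rw [h1]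
    · rw [h2]
    · rfl

theorem inv_fold {n : ℕ} (P : (Fin n → ℕ) → (Fin n → ℕ) → Prop)
    (hP : ∀ f g, P f g → ∀ j j' : Fin n, j'.val = j.val + 1 → f j ≤ f j' →
      P (srt f j j') (srt g j j'))
    (e : Fin n) (R : List ℕ) (hR : Alphabet n R) (w v : Equiv.Perm (Fin n))
    (hI : Inc n w R) (h : P (fun k => lam e (w k)) (fun k => lam e (v k))) :
    P (fun k => lam e ((w * wprod n R) k)) (fun k => lam e (R.foldl (up n) v k)) := by
  induction R generalizing w v with
  | nil => simpa [wprod] using h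
  | cons i R ih =>
    have hi : 1 ≤ i ∧ i < n := hR i (by simp)
    have hR' : Alphabet n R := fun j hj => hR j (by simp [hj])
    rw [wprod_cons, ← mul_assoc, List.foldl_cons]
    refine ih hR' _ _ hI.2 ?_
    have e1 : up n w i = w * sTr n i := by unfold up; rw [if_pos hI.1]
    rw [← e1, lam_up hi, lam_up hi]
    refine hP _ _ h _ _ (by simp; omega) ?_
    exact lam_mono e ((len_lt_iff' hi w).1 hI.1).le

theorem w0_anti {n : ℕ} {k l : Fin n} (h : k < l) : w0 n l < w0 n k := by
  simpa [w0] using h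

theorem pos_eq {n : ℕ} {e x : Fin n} {v : Equiv.Perm (Fin n)} (h : lam e (v x) = 1) :
    v⁻¹ e = x := by
  rw [Equiv.Perm.inv_eq_iff_eq]; exact (lam_eq_one h).symm

theorem final_L {n : ℕ} {e : Fin n} {v : Equiv.Perm (Fin n)}
    (h : InvL (fun k => lam e (w0 n k)) (fun k => lam e (v k))) : v⁻¹ e < (w0 n)⁻¹ e := by
  obtain ⟨x, y, z, hxy, hyz, gx, gy, gz, fz, hh, ho⟩ := h
  have := lam_mono e (w0_anti hxy).le
  rcases hh with ⟨h1, h2⟩ | ⟨h1, h2⟩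
  · dsimp only at h1 h2
    omega
  · rw [pos_eq gx, pos_eq h2]; exact hxy

theorem final_R {n : ℕ} {e : Fin n} {v : Equiv.Perm (Fin n)}
    (h : InvR (fun k => lam e (w0 n k)) (fun k => lam e (v k))) : (w0 n)⁻¹ e < v⁻¹ e := by
  obtain ⟨x, y, z, hxy, hyz, gx, gy, gz, fz, hh, ho⟩ := h
  have := lam_mono e (w0_anti hyz).le
  rcases hh with ⟨h1, h2⟩ | ⟨h1, h2⟩
  · dsimp only at h1 h2
    omega
  · rw [pos_eq gz, pos_eq h1]; exact hyz

theorem final_A {n : ℕ} {e : Fin n} {v : Equiv.Perm (Fin n)}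
    (h : InvA (fun k => lam e (w0 n k)) (fun k => lam e (v k))) : v⁻¹ e < (w0 n)⁻¹ e := by
  obtain ⟨x, y, hxy, gx, gy, fx, fy, ho⟩ := h
  rw [pos_eq gx, pos_eq fy]; exact hxy

theorem final_C {n : ℕ} {e : Fin n} {v : Equiv.Perm (Fin n)}
    (h : InvC (fun k => lam e (w0 n k)) (fun k => lam e (v k))) : (w0 n)⁻¹ e < v⁻¹ e := by
  obtain ⟨x, y, hxy, gx, gy, fx, fy, ho⟩ := h
  rw [pos_eq gy, pos_eq fx]; exact hxy

theorem final_E {n : ℕ} {e : Fin n} {v : Equiv.Perm (Fin n)}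
    (h : (fun k => lam e (w0 n k)) = (fun k => lam e (v k))) : (w0 n)⁻¹ e = v⁻¹ e := by
  have h1 : lam e (w0 n ((w0 n)⁻¹ e)) = 1 := by simp [lam]
  have h2 := congrFun h ((w0 n)⁻¹ e)
  rw [h1] at h2
  exact (pos_eq h2.symm).symm

set_option maxHeartbeats 4000000 in
/-- The starting situation just after the braid. -/
theorem start_cases {n : ℕ} (u w v v' : Equiv.Perm (Fin n)) (j0 j1 j2 : Fin n)
    (h01 : j1.val = j0.val + 1) (h12 : j2.val = j1.val + 1)
    (hab : u j0 < u j1) (hbc : u j1 < u j2)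
    (w0' : w j0 = u j2) (w1 : w j1 = u j1) (w2 : w j2 = u j0)
    (v0 : v j0 = u j1) (v1 : v j1 = u j0) (v2 : v j2 = u j2)
    (v0' : v' j0 = u j0) (v1' : v' j1 = u j2) (v2' : v' j2 = u j1)
    (ho : ∀ o, o ≠ j0 → o ≠ j1 → o ≠ j2 → w o = u o ∧ v o = u o ∧ v' o = u o) (e : Fin n) :
    ((e < u j0 ∨ u j2 < e) ∧ (fun k => lam e (w k)) = (fun k => lam e (v k)) ∧
      (fun k => lam e (w k)) = (fun k => lam e (v' k))) ∨
    (e = u j0 ∧ InvA (fun k => lam e (w k)) (fun k => lam e (v k)) ∧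
      InvA (fun k => lam e (w k)) (fun k => lam e (v' k))) ∨
    (e = u j2 ∧ InvC (fun k => lam e (w k)) (fun k => lam e (v k)) ∧
      InvC (fun k => lam e (w k)) (fun k => lam e (v' k))) ∨
    (e = u j1 ∧ InvL (fun k => lam e (w k)) (fun k => lam e (v k)) ∧
      InvR (fun k => lam e (w k)) (fun k => lam e (v' k))) ∨
    ((u j0 < e ∧ e < u j2 ∧ e ≠ u j1) ∧ InvL (fun k => lam e (w k)) (fun k => lam e (v k)) ∧
      InvL (fun k => lam e (w k)) (fun k => lam e (v' k))) ∨
    ((u j0 < e ∧ e < u j2 ∧ e ≠ u j1) ∧ InvR (fun k => lam e (w k)) (fun k => lam e (v k)) ∧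
      InvR (fun k => lam e (w k)) (fun k => lam e (v' k))) := by
  have lt0 : ∀ k, k < e → lam e k = 0 := fun k h => by simp [lam, h]
  have gt2 : ∀ k, e < k → lam e k = 2 := fun k h => by simp [lam, not_lt.2 h.le, h.ne']
  have eq1 : lam e e = 1 := by simp [lam]
  have ne1 : ∀ k, k ≠ e → lam e k = 0 ∨ lam e k = 2 := fun k h => by
    rcases lt_or_gt_of_ne h with h | h
    · exact Or.inl (lt0 k h)
    · exact Or.inr (gt2 k h)
  obtain ⟨k0, hk0⟩ : ∃ k0, u k0 = e := ⟨u⁻¹ e, by simp⟩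
  have inj : ∀ o, o ≠ k0 → u o ≠ e := fun o h h2 => h (u.injective (h2.trans hk0.symm))
  have hac := hab.trans hbc
  have l01 : j0 < j1 := by rw [Fin.lt_def]; omega
  have l12 : j1 < j2 := by rw [Fin.lt_def]; omega
  by_cases c0 : e < u j0
  · left
    refine ⟨Or.inl c0, ?_, ?_⟩ <;> funext k <;>
    · by_cases k0 : k = j0
      · grind
      · by_cases k1 : k = j1
        · grind
        · by_cases k2 : k = j2
          · grind
          · have := ho k k0 k1 k2
            grind
  by_cases c1 : u j2 < e
  · left
    refine ⟨Or.inr c1, ?_, ?_⟩ <;> funext k <;>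
    · by_cases k0 : k = j0
      · grind
      · by_cases k1 : k = j1
        · grind
        · by_cases k2 : k = j2
          · grind
          · have := ho k k0 k1 k2
            grind
  right
  by_cases c2 : e = u j0
  · left
    refine ⟨c2, ⟨j1, j2, ?_⟩, ⟨j0, j2, ?_⟩⟩
    · refine ⟨l12, by grind, by grind, by grind, by grind, fun o _ _ => ?_⟩
      by_cases o = j0 <;> grind
    · refine ⟨l01.trans l12, by grind, by grind, by grind, by grind, fun o _ _ => ?_⟩
      by_cases o = j1 <;> grind
  right
  by_cases c3 : e = u j2
  · left
    refine ⟨c3, ⟨j0, j2, ?_⟩, ⟨j0, j1, ?_⟩⟩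
    · refine ⟨l01.trans l12, by grind, by grind, by grind, by grind, fun o _ _ => ?_⟩
      by_cases o = j1 <;> grind
    · refine ⟨l01, by grind, by grind, by grind, by grind, fun o _ _ => ?_⟩
      by_cases o = j2 <;> grind
  right
  have d0 : u j0 < e := lt_of_le_of_ne (not_lt.1 c0) (Ne.symm c2)
  have d2 : e < u j2 := lt_of_le_of_ne (not_lt.1 c1) c3
  by_cases c4 : e = u j1
  · left
    refine ⟨c4, ⟨j0, j1, j2, l01, l12, ?_⟩, ⟨j0, j1, j2, l01, l12, ?_⟩⟩
    · refine ⟨by grind, by grind, by grind, by grind, by grind, fun o _ _ _ => ?_⟩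
      grind
    · refine ⟨by grind, by grind, by grind, by grind, by grind, fun o _ _ _ => ?_⟩
      grind
  right
  have n0 : k0 ≠ j0 := by grind
  have n1 : k0 ≠ j1 := by grind
  have n2 : k0 ≠ j2 := by grind
  have hk := ho k0 n0 n1 n2
  by_cases c5 : k0 < j0
  · left
    refine ⟨⟨d0, d2, c4⟩, ?_⟩
    by_cases c6 : u j1 < e
    · refine ⟨⟨k0, j0, j2, c5, by order, ?_⟩, ⟨k0, j0, j1, c5, by order, ?_⟩⟩
      · refine ⟨by grind, by grind, by grind, by grind, by grind, fun o _ _ _ => ?_⟩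
        by_cases o = j1 <;> grind
      · refine ⟨by grind, by grind, by grind, by grind, by grind, fun o _ _ _ => ?_⟩
        by_cases o = j2 <;> grind
    · have c7 : e < u j1 := lt_of_le_of_ne (not_lt.1 c6) c4
      refine ⟨⟨k0, j1, j2, by order, by order, ?_⟩, ⟨k0, j0, j2, c5, by order, ?_⟩⟩
      · refine ⟨by grind, by grind, by grind, by grind, by grind, fun o _ _ _ => ?_⟩
        by_cases o = j0 <;> grind
      · refine ⟨by grind, by grind, by grind, by grind, by grind, fun o _ _ _ => ?_⟩
        by_cases o = j1 <;> grind
  · right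
    have c5' : j2 < k0 := by
      rw [Fin.lt_def] at c5 ⊢
      simp only [ne_eq, Fin.ext_iff] at n0 n1 n2
      omega
    refine ⟨⟨d0, d2, c4⟩, ?_⟩
    by_cases c6 : u j1 < e
    · refine ⟨⟨j0, j2, k0, by order, by order, ?_⟩, ⟨j0, j1, k0, by order, by order, ?_⟩⟩
      · refine ⟨by grind, by grind, by grind, by grind, by grind, fun o _ _ _ => ?_⟩
        by_cases o = j1 <;> grind
      · refine ⟨by grind, by grind, by grind, by grind, by grind, fun o _ _ _ => ?_⟩
        by_cases o = j2 <;> grind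
    · have c7 : e < u j1 := lt_of_le_of_ne (not_lt.1 c6) c4
      refine ⟨⟨j1, j2, k0, by order, by order, ?_⟩, ⟨j0, j2, k0, by order, by order, ?_⟩⟩
      · refine ⟨by grind, by grind, by grind, by grind, by grind, fun o _ _ _ => ?_⟩
        by_cases o = j0 <;> grind
      · refine ⟨by grind, by grind, by grind, by grind, by grind, fun o _ _ _ => ?_⟩
        by_cases o = j1 <;> grind

/-! ### The braid relation for Demazure steps -/

theorem up_apply {n i : ℕ} (h : 1 ≤ i ∧ i < n) (v : Equiv.Perm (Fin n)) (k : Fin n) :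
    up n v i k = if k = ⟨i - 1, by omega⟩ then max (v ⟨i - 1, by omega⟩) (v ⟨i, h.2⟩)
      else if k = ⟨i, h.2⟩ then min (v ⟨i - 1, by omega⟩) (v ⟨i, h.2⟩) else v k := by
  unfold up
  have hl := len_lt_iff' h v
  by_cases hc : len v < len (v * sTr n i)
  · rw [if_pos hc]
    rw [hl] at hc
    rw [sTr_eq h, Equiv.Perm.mul_apply, Equiv.swap_apply_def, max_eq_right hc.le,
      min_eq_left hc.le]
    split_ifs <;> rfl
  · rw [if_neg hc]
    rw [hl, not_lt] at hc
    rw [max_eq_left hc, min_eq_right hc]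
    split_ifs with h1 h2
    · rw [h1]
    · rw [h2]
    · rfl

theorem up_braid {n i : ℕ} (h : 1 ≤ i ∧ i + 1 < n) (v : Equiv.Perm (Fin n)) :
    up n (up n (up n v i) (i + 1)) i = up n (up n (up n v (i + 1)) i) (i + 1) := by
  have hi : 1 ≤ i ∧ i < n := by omega
  have hi' : 1 ≤ i + 1 ∧ i + 1 < n := by omega
  have n01 : (⟨i - 1, by omega⟩ : Fin n) ≠ ⟨i, by omega⟩ := by
    rw [ne_eq, Fin.ext_iff]; simp only; omega
  have n02 : (⟨i - 1, by omega⟩ : Fin n) ≠ ⟨i + 1, by omega⟩ := by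
    rw [ne_eq, Fin.ext_iff]; simp only; omega
  have n12 : (⟨i, by omega⟩ : Fin n) ≠ ⟨i + 1, by omega⟩ := by simp [Fin.ext_iff]
  ext1 k
  simp only [up_apply hi, up_apply hi', Nat.add_sub_cancel, n01, n02, n12, n01.symm, n02.symm,
    n12.symm, if_true, if_false]
  generalize v ⟨i - 1, by omega⟩ = x
  generalize v ⟨i, by omega⟩ = y
  generalize v ⟨i + 1, by omega⟩ = z
  split_ifs <;> first | rfl | grind

/-! ### Positions -/

theorem posOf_eq {n t : ℕ} (x : Equiv.Perm (Fin n)) (h : 1 ≤ t ∧ t ≤ n) :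
    posOf x t = (x⁻¹ (⟨t - 1, by omega⟩ : Fin n)).val + 1 := by
  simp [posOf, app, h]

theorem sigma_neg {n t : ℕ} {x : Equiv.Perm (Fin n)} (h : 1 ≤ t ∧ t ≤ n)
    (hx : x⁻¹ (⟨t - 1, by omega⟩ : Fin n) < (w0 n)⁻¹ (⟨t - 1, by omega⟩ : Fin n)) :
    sigmaVal n t x = -1 := by
  unfold sigmaVal
  rw [posOf_eq x h, posOf_eq (w0 n) h]
  apply Int.sign_eq_neg_one_of_neg
  rw [Fin.lt_def] at hx
  omega

theorem sigma_pos {n t : ℕ} {x : Equiv.Perm (Fin n)} (h : 1 ≤ t ∧ t ≤ n)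
    (hx : (w0 n)⁻¹ (⟨t - 1, by omega⟩ : Fin n) < x⁻¹ (⟨t - 1, by omega⟩ : Fin n)) :
    sigmaVal n t x = 1 := by
  unfold sigmaVal
  rw [posOf_eq x h, posOf_eq (w0 n) h]
  apply Int.sign_eq_one_of_pos
  rw [Fin.lt_def] at hx
  omega

theorem sigma_zero {n t : ℕ} {x : Equiv.Perm (Fin n)} (h : 1 ≤ t ∧ t ≤ n)
    (hx : (w0 n)⁻¹ (⟨t - 1, by omega⟩ : Fin n) = x⁻¹ (⟨t - 1, by omega⟩ : Fin n)) :
    sigmaVal n t x = 0 := by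
  unfold sigmaVal
  rw [posOf_eq x h, posOf_eq (w0 n) h, hx]
  simp

theorem mem_Supp_iff {n t : ℕ} (x : Equiv.Perm (Fin n)) :
    t ∈ Supp n x ↔ (1 ≤ t ∧ t ≤ n) ∧ sigmaVal n t x ≠ 0 := by
  unfold Supp sigmaVal
  rw [Finset.mem_filter, Finset.mem_Icc, ne_eq, ne_eq, Int.sign_eq_zero_iff_zero, sub_eq_zero]
  norm_cast

/-- The key comparison of the two exceptional paths. -/
theorem key_sigma {n i : ℕ} (hi : 1 ≤ i ∧ i + 1 < n) (T₂ : List ℕ) (hT : Alphabet n T₂)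
    (u : Equiv.Perm (Fin n))
    (hab : u ⟨i - 1, by omega⟩ < u ⟨i, by omega⟩) (hbc : u ⟨i, by omega⟩ < u ⟨i + 1, hi.2⟩)
    (hI : Inc n (u * sTr n i * sTr n (i + 1) * sTr n i) T₂)
    (hw : u * sTr n i * sTr n (i + 1) * sTr n i * wprod n T₂ = w0 n)
    (t : ℕ) (ht : 1 ≤ t ∧ t ≤ n) :
    let σ := sigmaVal n t (T₂.foldl (up n) (u * sTr n i))
    let σ' := sigmaVal n t (T₂.foldl (up n) (u * sTr n (i + 1)))
    ((t < app u i ∨ app u (i + 2) < t) → σ = 0 ∧ σ' = 0) ∧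
    ((app u i ≤ t ∧ t ≤ app u (i + 2)) → σ ≠ 0 ∧ σ' ≠ 0) ∧
    (t = app u (i + 1) → σ = -1 ∧ σ' = 1) ∧
    (t ≠ app u (i + 1) → σ = σ') := by
  have hi1 : 1 ≤ i ∧ i < n := by omega
  have hi2 : 1 ≤ i + 1 ∧ i + 1 < n := by omega
  have n01 : (⟨i - 1, by omega⟩ : Fin n) ≠ ⟨i, by omega⟩ := by
    rw [ne_eq, Fin.ext_iff]; simp only; omega
  have n02 : (⟨i - 1, by omega⟩ : Fin n) ≠ ⟨i + 1, by omega⟩ := by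
    rw [ne_eq, Fin.ext_iff]; simp only; omega
  have n12 : (⟨i, by omega⟩ : Fin n) ≠ ⟨i + 1, by omega⟩ := by simp [Fin.ext_iff]
  have a0 : app u i = (u ⟨i - 1, by omega⟩).val + 1 := by
    unfold app; rw [dif_pos (by omega)]
  have a1 : app u (i + 1) = (u ⟨i, by omega⟩).val + 1 := by
    unfold app; rw [dif_pos (by omega)]; simp
  have a2 : app u (i + 2) = (u ⟨i + 1, by omega⟩).val + 1 := by
    unfold app; rw [dif_pos (by omega)]; simp
  have hac := hab.trans hbc
  intro σ σ'
  have st := start_cases u (u * sTr n i * sTr n (i + 1) * sTr n i) (u * sTr n i)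
    (u * sTr n (i + 1)) ⟨i - 1, by omega⟩ ⟨i, by omega⟩ ⟨i + 1, by omega⟩
    (by simp; omega) (by simp) hab hbc
    (by simp [sTr_eq hi1, sTr_eq hi2, Equiv.swap_apply_def, n01, n02, n12, n01.symm, n02.symm,
      n12.symm])
    (by simp [sTr_eq hi1, sTr_eq hi2, Equiv.swap_apply_def, n01, n02, n12, n01.symm, n02.symm,
      n12.symm])
    (by simp [sTr_eq hi1, sTr_eq hi2, Equiv.swap_apply_def, n01, n02, n12, n01.symm, n02.symm,
      n12.symm])
    (by simp [sTr_eq hi1]) (by simp [sTr_eq hi1])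
    (by simp [sTr_eq hi1, Equiv.swap_apply_def, n02.symm, n12.symm])
    (by simp [sTr_eq hi2, Equiv.swap_apply_def, n01, n02])
    (by simp [sTr_eq hi2]) (by simp [sTr_eq hi2])
    (by
      intro o h0 h1 h2
      simp [sTr_eq hi1, sTr_eq hi2, Equiv.swap_apply_def, h0, h1, h2])
    ⟨t - 1, by omega⟩
  simp only [Fin.lt_def, Fin.ext_iff, ne_eq] at st hab hbc hac
  have htn : t - 1 < n := by omega
  let E : Fin n := ⟨t - 1, htn⟩
  have gL : ∀ v, InvL (fun k => lam E ((u * sTr n i * sTr n (i + 1) * sTr n i) k))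
      (fun k => lam E (v k)) → (T₂.foldl (up n) v)⁻¹ E < (w0 n)⁻¹ E := by
    intro v h
    have h2 := inv_fold InvL (fun f g h => h.step) E T₂ hT _ v hI h
    rw [hw] at h2
    exact final_L h2
  have gR : ∀ v, InvR (fun k => lam E ((u * sTr n i * sTr n (i + 1) * sTr n i) k))
      (fun k => lam E (v k)) → (w0 n)⁻¹ E < (T₂.foldl (up n) v)⁻¹ E := by
    intro v h
    have h2 := inv_fold InvR (fun f g h => h.step) E T₂ hT _ v hI h
    rw [hw] at h2
    exact final_R h2
  have gA : ∀ v, InvA (fun k => lam E ((u * sTr n i * sTr n (i + 1) * sTr n i) k))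
      (fun k => lam E (v k)) → (T₂.foldl (up n) v)⁻¹ E < (w0 n)⁻¹ E := by
    intro v h
    have h2 := inv_fold InvA (fun f g h => h.step) E T₂ hT _ v hI h
    rw [hw] at h2
    exact final_A h2
  have gC : ∀ v, InvC (fun k => lam E ((u * sTr n i * sTr n (i + 1) * sTr n i) k))
      (fun k => lam E (v k)) → (w0 n)⁻¹ E < (T₂.foldl (up n) v)⁻¹ E := by
    intro v h
    have h2 := inv_fold InvC (fun f g h => h.step) E T₂ hT _ v hI h
    rw [hw] at h2
    exact final_C h2
  have gE : ∀ v, Eq (fun k => lam E ((u * sTr n i * sTr n (i + 1) * sTr n i) k))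
      (fun k => lam E (v k)) → (w0 n)⁻¹ E = (T₂.foldl (up n) v)⁻¹ E := by
    intro v h
    have h2 := inv_fold Eq (fun f g h => fun j j' _ _ => by rw [h]) E T₂ hT _ v hI h
    rw [hw] at h2
    exact final_E h2
  rw [a0, a1, a2]
  rcases st with ⟨h, p, q⟩ | ⟨h, p, q⟩ | ⟨h, p, q⟩ | ⟨h, p, q⟩ | ⟨h, p, q⟩ | ⟨h, p, q⟩
  · have s1 : σ = 0 := sigma_zero ht (gE _ p)
    have s2 : σ' = 0 := sigma_zero ht (gE _ q)
    rw [s1, s2]; omega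
  · have s1 : σ = -1 := sigma_neg ht (gA _ p)
    have s2 : σ' = -1 := sigma_neg ht (gA _ q)
    rw [s1, s2]; omega
  · have s1 : σ = 1 := sigma_pos ht (gC _ p)
    have s2 : σ' = 1 := sigma_pos ht (gC _ q)
    rw [s1, s2]; omega
  · have s1 : σ = -1 := sigma_neg ht (gL _ p)
    have s2 : σ' = 1 := sigma_pos ht (gR _ q)
    rw [s1, s2]; omega
  · have s1 : σ = -1 := sigma_neg ht (gL _ p)
    have s2 : σ' = -1 := sigma_neg ht (gL _ q)
    rw [s1, s2]; omega
  · have s1 : σ = 1 := sigma_pos ht (gR _ p)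
    have s2 : σ' = 1 := sigma_pos ht (gR _ q)
    rw [s1, s2]; omega


/-- Suppose `R₁ = T₁·i(i+1)i·T₂` and
`R₂ = T₁·(i+1)i(i+1)·T₂` are both reduced words for `w₀ ∈ S_n`; let
`u = w(T₁)`, `a = u(i)`, `b = u(i+1)`, `c = u(i+2)` (then `a < b < c`), and
assume `T_{R₁}(a,b,c) = +1` and `T_{R₂}(a,b,c) = −1`.  Then for every triple
`1 ≤ d < e < f ≤ n`: `Θ_{R₁}(d,e,f) − Θ_{R₂}(d,e,f) = −2` if
`(d,e,f) = (a,b,c)`, and `= 0` otherwise. -/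
theorem theta_variation_of_braid
    (n : ℕ) (hn : 2 ≤ n) (T₁ T₂ : List ℕ) (i : ℕ)
    (hi : 1 ≤ i ∧ i ≤ n - 2)
    (hred₁ : IsReducedWordFor n (T₁ ++ [i, i + 1, i] ++ T₂) (w0 n))
    (hred₂ : IsReducedWordFor n (T₁ ++ [i + 1, i, i + 1] ++ T₂) (w0 n))
    (u : Equiv.Perm (Fin n)) (hu : u = wprod n T₁)
    (a b c : ℕ) (ha : a = app u i) (hb : b = app u (i + 1)) (hc : c = app u (i + 2))
    (hT₁ : T n (T₁ ++ [i, i + 1, i] ++ T₂) a b c = 1)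
    (hT₂ : T n (T₁ ++ [i + 1, i, i + 1] ++ T₂) a b c = -1) :
    a < b ∧ b < c ∧
    ∀ d e f : ℕ, 1 ≤ d → d < e → e < f → f ≤ n →
      ((d, e, f) = (a, b, c) →
        Theta n (T₁ ++ [i, i + 1, i] ++ T₂) d e f
          - Theta n (T₁ ++ [i + 1, i, i + 1] ++ T₂) d e f = -2) ∧
      ((d, e, f) ≠ (a, b, c) →
        Theta n (T₁ ++ [i, i + 1, i] ++ T₂) d e f
          = Theta n (T₁ ++ [i + 1, i, i + 1] ++ T₂) d e f) := by
  have hi' : 1 ≤ i ∧ i + 1 < n := by omega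
  have hi1 : 1 ≤ i ∧ i < n := by omega
  have hi2 : 1 ≤ i + 1 ∧ i + 1 < n := by omega
  have I1 := Inc_of_reduced hred₁.1
  have I2 := Inc_of_reduced hred₂.1
  simp only [Inc_append, one_mul, wprod_append, ← hu] at I1 I2
  obtain ⟨⟨IT, J1⟩, K1⟩ := I1
  obtain ⟨⟨-, J2⟩, K2⟩ := I2
  have W1 := hred₁.2
  simp only [wprod_append, ← hu] at W1
  have e1 : wprod n [i, i + 1, i] = sTr n i * (sTr n (i + 1) * sTr n i) := by simp [wprod]
  have e2 : wprod n [i + 1, i, i + 1] = sTr n (i + 1) * (sTr n i * sTr n (i + 1)) := by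
    simp [wprod]
  rw [e1, ← mul_assoc, ← mul_assoc] at W1 K1
  obtain ⟨p1, p2, p3, -⟩ := J1
  obtain ⟨q1, q2, q3, -⟩ := J2
  have hab := (len_lt_iff' hi1 u).1 p1
  have hbc := (len_lt_iff' hi2 u).1 q1
  simp only [Nat.add_sub_cancel] at hbc
  have hT₂ : Alphabet n T₂ := fun j hj => hred₁.1.1 j (by simp [hj])
  have a0 : a = (u ⟨i - 1, by omega⟩).val + 1 := by
    rw [ha]; unfold app; rw [dif_pos (by omega)]
  have a1 : b = (u ⟨i, by omega⟩).val + 1 := by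
    rw [hb]; unfold app; rw [dif_pos (by omega)]; simp
  have a2 : c = (u ⟨i + 1, by omega⟩).val + 1 := by
    rw [hc]; unfold app; rw [dif_pos (by omega)]; simp
  have hab' : a < b := by rw [Fin.lt_def] at hab; omega
  have hbc' : b < c := by rw [Fin.lt_def] at hbc; omega
  have hcn : c ≤ n := by rw [a2]; exact (u ⟨i + 1, by omega⟩).isLt
  refine ⟨hab', hbc', ?_⟩
  intro d e f hd hde hef hfn
  -- the two exceptional end points
  have K := key_sigma hi' T₂ hT₂ u hab hbc K1 W1
  rw [← ha, ← hb, ← hc] at K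
  -- the difference of the two thetas
  have L1 : (T₁ ++ [i, i + 1, i] ++ T₂).length = n * (n - 1) / 2 := by
    rw [hred₁.1.2, hred₁.2, len_w0]
  have L2 : (T₁ ++ [i + 1, i, i + 1] ++ T₂).length = n * (n - 1) / 2 := by
    rw [hred₂.1.2, hred₂.2, len_w0]
  have fu : T₁.foldl (up n) 1 = u := by rw [foldl_up_of_Inc n T₁ 1 IT, one_mul, hu]
  have upi : up n u i = u * sTr n i := by unfold up; rw [if_pos p1]
  have upi' : up n u (i + 1) = u * sTr n (i + 1) := by unfold up; rw [if_pos q1]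
  have up2 : up n (u * sTr n i) (i + 1) = u * sTr n i * sTr n (i + 1) := by
    unfold up; rw [if_pos p2]
  have up2' : up n (u * sTr n (i + 1)) i = u * sTr n (i + 1) * sTr n i := by
    unfold up; rw [if_pos q2]
  have dn1 : dn n u i = u := by unfold dn; rw [if_pos p1]
  have dn1' : dn n u (i + 1) = u := by unfold dn; rw [if_pos q1]
  have dn2 : dn n (u * sTr n i) (i + 1) = u * sTr n i := by unfold dn; rw [if_pos p2]
  have dn2' : dn n (u * sTr n (i + 1)) i = u * sTr n (i + 1) := by unfold dn; rw [if_pos q2]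
  have dn3 : dn n (u * sTr n i * sTr n (i + 1)) i = u * sTr n i * sTr n (i + 1) := by
    unfold dn; rw [if_pos p3]
  have dn3' : dn n (u * sTr n (i + 1) * sTr n i) (i + 1) = u * sTr n (i + 1) * sTr n i := by
    unfold dn; rw [if_pos q3]
  have idem : ∀ (v : Equiv.Perm (Fin n)) (j : ℕ), len v < len (v * sTr n j) →
      up n (v * sTr n j) j = v * sTr n j := by
    intro v j h
    unfold up
    rw [mul_assoc, sTr_mul_self, mul_one, if_neg (by omega)]
  have b1 : lst n u [i, i + 1, i] =
      [u * sTr n (i + 1) * sTr n i, u * sTr n i, u * sTr n i * sTr n (i + 1)] := by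
    simp only [lst, List.foldl_cons, List.foldl_nil, dn1, upi, upi', up2', dn2, idem u i p1, up2,
      dn3]
  have b2 : lst n u [i + 1, i, i + 1] =
      [u * sTr n i * sTr n (i + 1), u * sTr n (i + 1), u * sTr n (i + 1) * sTr n i] := by
    simp only [lst, List.foldl_cons, List.foldl_nil, dn1', upi, upi', up2', dn2',
      idem u (i + 1) q1, up2, dn3']
  have br : ∀ v : Equiv.Perm (Fin n), [i, i + 1, i].foldl (up n) v
      = [i + 1, i, i + 1].foldl (up n) v := fun v => by
    simp only [List.foldl_cons, List.foldl_nil]; exact up_braid hi' v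
  have diff : Theta n (T₁ ++ [i, i + 1, i] ++ T₂) d e f
      - Theta n (T₁ ++ [i + 1, i, i + 1] ++ T₂) d e f
      = phi n d e f (T₂.foldl (up n) (u * sTr n i))
        - phi n d e f (T₂.foldl (up n) (u * sTr n (i + 1))) := by
    rw [Theta_eq n _ hred₁.1.1 L1 (by simp; omega), Theta_eq n _ hred₂.1.1 L2 (by simp; omega)]
    simp only [lst_append, List.foldl_append, fu, b1, b2, br]
    simp only [List.map_append, List.sum_append, List.map_cons, List.map_nil, List.sum_cons,
      List.sum_nil]
    ring
  have supp : ∀ x : Equiv.Perm (Fin n),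
      (∀ t, 1 ≤ t ∧ t ≤ n → ((t < a ∨ c < t) → sigmaVal n t x = 0) ∧
        ((a ≤ t ∧ t ≤ c) → sigmaVal n t x ≠ 0)) → Supp n x = Finset.Icc a c := by
    intro x hx
    ext t
    rw [mem_Supp_iff, Finset.mem_Icc]
    constructor
    · rintro ⟨h1, h2⟩
      by_contra hcon
      exact h2 ((hx t h1).1 (by omega))
    · intro h
      have h1 : 1 ≤ t ∧ t ≤ n := by omega
      exact ⟨h1, (hx t h1).2 h⟩
  have S1 := supp (T₂.foldl (up n) (u * sTr n i))
    (fun t ht => ⟨fun h => ((K t ht).1 h).1, fun h => ((K t ht).2.1 h).1⟩)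
  have S2 := supp (T₂.foldl (up n) (u * sTr n (i + 1)))
    (fun t ht => ⟨fun h => ((K t ht).1 h).2, fun h => ((K t ht).2.1 h).2⟩)
  unfold phi at diff
  rw [S1, S2] at diff
  have Ke := K e (by omega)
  constructor
  · intro heq
    simp only [Prod.mk.injEq] at heq
    obtain ⟨rfl, rfl, rfl⟩ := heq
    obtain ⟨h1, h2⟩ := Ke.2.2.1 rfl
    rw [if_pos rfl, if_pos rfl, h1, h2] at diff
    exact diff
  · intro hne
    by_cases hI : Finset.Icc a c = Finset.Icc d f
    · have m1 : d ∈ Finset.Icc a c := by rw [hI, Finset.mem_Icc]; omega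
      have m2 : f ∈ Finset.Icc a c := by rw [hI, Finset.mem_Icc]; omega
      have m3 : a ∈ Finset.Icc d f := by rw [← hI, Finset.mem_Icc]; omega
      have m4 : c ∈ Finset.Icc d f := by rw [← hI, Finset.mem_Icc]; omega
      rw [Finset.mem_Icc] at m1 m2 m3 m4
      have hda : d = a := by omega
      have hfc : f = c := by omega
      have heb : e ≠ b := fun h => hne (by rw [hda, hfc, h])
      rw [if_pos hI, if_pos hI, Ke.2.2.2 heb, sub_self] at diff
      exact sub_eq_zero.1 diff
    · rw [if_neg hI, if_neg hI, sub_self] at diff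
      exact sub_eq_zero.1 diff

end BSDist
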